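/- Let 0 < p < 1, let A, B be positive contractions on a Hilbert space H (0 ≤ A, B ≤ I_H), let λ ∈ [0,1], and let Φ be a unital positive linear map on B(H). Then Φ((I_H − A)^p ∇_λ (I_H − B)^p) ≤ (Φ(I_H − A ∇_λ B))^p. -/

import Mathlib

section Helpers

open Set MeasureTheory

variable {𝒜 : Type*} [CStarAlgebra 𝒜] [PartialOrder 𝒜] [StarOrderedRing 𝒜]

/-- Jensen's operator inequality for the inverse and finitely many positive weights. -/
lemma bellman_inverse_aux {ι : Type*} (s : Finset ι) (a : ι → 𝒜) (r : ι → ℝ)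
    (ha : ∀ i ∈ s, 0 ≤ a i) (hsum : ∑ i ∈ s, a i = 1) (hr : ∀ i ∈ s, 0 < r i)
    (c : 𝒜) (hc : IsSelfAdjoint c) (hcS : c * (∑ i ∈ s, r i • a i) = 1) :
    c ≤ ∑ i ∈ s, (r i)⁻¹ • a i := by
  have h0 : 0 ≤ ∑ i ∈ s, (r i)⁻¹ • (star (1 - r i • c) * a i * (1 - r i • c)) := by
    refine Finset.sum_nonneg fun i hi => ?_
    exact smul_nonneg (inv_nonneg.2 (hr i hi).le) (star_left_conjugate_nonneg (ha i hi) _)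
  have h1 : ∑ i ∈ s, (r i)⁻¹ • (star (1 - r i • c) * a i * (1 - r i • c))
      = ∑ i ∈ s, ((r i)⁻¹ • a i - c * a i - a i * c + c * (r i • a i) * c) := by
    refine Finset.sum_congr rfl fun i hi => ?_
    have hne : r i ≠ 0 := (hr i hi).ne'
    simp only [star_sub, star_one, star_smul, hc.star_eq, star_trivial, sub_mul, mul_sub, one_mul,
      mul_one, smul_mul_assoc, mul_smul_comm, smul_sub, smul_smul, inv_mul_cancel₀ hne, one_smul]
    rw [← mul_assoc, inv_mul_cancel₀ hne, one_mul]
    abel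
  rw [h1] at h0
  simp only [Finset.sum_add_distrib, Finset.sum_sub_distrib, ← Finset.mul_sum, ← Finset.sum_mul,
    hsum, hcS, mul_one, one_mul] at h0
  simpa using h0

lemma bellman_integrand_eq {p t : ℝ} (hp : p ∈ Ioo (0:ℝ) 1) (ht : 0 < t) (x : 𝒜) (hx : 0 ≤ x) :
    cfcₙ (Real.rpowIntegrand₀₁ p t) x =
        algebraMap ℝ 𝒜 (t ^ (p - 1)) - t ^ p • Ring.inverse (algebraMap ℝ 𝒜 t + x) := by
  rw [cfcₙ_eq_cfc ((Real.continuousOn_rpowIntegrand₀₁_Ici hp ht).mono (by grind)) (by simp)]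
  rw [Real.rpowIntegrand₀₁_eq_sub (by grind) ht]
  have hg : ContinuousOn (fun z : ℝ => (t + z)⁻¹) (spectrum ℝ x) := by
    fun_prop (disch := grind -abstractProof)
  have hf : ContinuousOn (fun z : ℝ => (t + z)) (spectrum ℝ x) := by fun_prop
  have hk : ContinuousOn (fun z : ℝ => t ^ p * (t + z)⁻¹) (spectrum ℝ x) := hg.const_mul _
  have hspectrum :  ∀ r ∈ spectrum ℝ x, t + r ≠ 0 := by grind
  have := cfc_sub (fun _ : ℝ => t ^ (p - 1)) (fun z : ℝ => t ^ p * (t + z)⁻¹) x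
    continuousOn_const hk
  rw [this, cfc_const .., cfc_const_mul _ _ _ hg, cfc_inv _ _ hspectrum hf, cfc_const_add ..,
      cfc_id' ..]

lemma bellman_integrand_scalar {p t : ℝ} (hp : p ∈ Ioo (0:ℝ) 1) (ht : 0 < t) (x : ℝ) (hx : 0 ≤ x) :
    cfcₙ (Real.rpowIntegrand₀₁ p t) (algebraMap ℝ 𝒜 x) =
        algebraMap ℝ 𝒜 (t ^ (p - 1) - t ^ p * (t + x)⁻¹) := by
  have hx' : (0 : 𝒜) ≤ algebraMap ℝ 𝒜 x := algebraMap_nonneg _ hx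
  rw [cfcₙ_eq_cfc ((Real.continuousOn_rpowIntegrand₀₁_Ici hp ht).mono (by grind)) (by simp)]
  rw [Real.rpowIntegrand₀₁_eq_sub (by grind) ht, cfc_algebraMap]

lemma bellman_integrand_jensen {ι : Type*} (s : Finset ι) (a : ι → 𝒜) (r : ι → ℝ)
    (ha : ∀ i ∈ s, 0 ≤ a i) (hsum : ∑ i ∈ s, a i = 1) (hr : ∀ i ∈ s, 0 ≤ r i)
    {p t : ℝ} (hp : p ∈ Ioo (0:ℝ) 1) (ht : 0 < t) :
    ∑ i ∈ s, cfcₙ (Real.rpowIntegrand₀₁ p t) (algebraMap ℝ 𝒜 (r i)) * a i ≤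
      cfcₙ (Real.rpowIntegrand₀₁ p t) (∑ i ∈ s, r i • a i) := by
  have hS : 0 ≤ ∑ i ∈ s, r i • a i :=
    Finset.sum_nonneg fun i hi => smul_nonneg (hr i hi) (ha i hi)
  rw [bellman_integrand_eq hp ht _ hS]
  have hT : IsStrictlyPositive (algebraMap ℝ 𝒜 t + ∑ i ∈ s, r i • a i) :=
    IsStrictlyPositive.add_nonneg (by
      exact IsStrictlyPositive.iff_of_unital.2 ⟨algebraMap_nonneg _ ht.le,
        (isUnit_iff_ne_zero.2 ht.ne').map (algebraMap ℝ 𝒜)⟩) hS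
  have hTS : ∑ i ∈ s, (t + r i) • a i = algebraMap ℝ 𝒜 t + ∑ i ∈ s, r i • a i := by
    simp only [add_smul, Finset.sum_add_distrib, ← Finset.smul_sum, hsum, Algebra.algebraMap_eq_smul_one]
  have key := bellman_inverse_aux s a (fun i => t + r i) ha hsum
    (fun i hi => by have := hr i hi; positivity)
    (Ring.inverse (algebraMap ℝ 𝒜 t + ∑ i ∈ s, r i • a i))
    (hT.ringInverse.nonneg.isSelfAdjoint)
    (by rw [hTS]; exact Ring.inverse_mul_cancel _ hT.isUnit)
  have : ∑ i ∈ s, cfcₙ (Real.rpowIntegrand₀₁ p t) (algebraMap ℝ 𝒜 (r i)) * a i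
      = algebraMap ℝ 𝒜 (t ^ (p - 1)) - t ^ p • ∑ i ∈ s, (t + r i)⁻¹ • a i := by
    rw [Finset.sum_congr rfl fun i hi => by
      rw [bellman_integrand_scalar hp ht _ (hr i hi), ← Algebra.smul_def, sub_smul, mul_smul]]
    rw [Finset.sum_sub_distrib, ← Finset.smul_sum, ← Finset.smul_sum, hsum,
      Algebra.algebraMap_eq_smul_one]
  rw [this]
  gcongr

lemma bellman_jensen {ι : Type*} (s : Finset ι) (a : ι → 𝒜) (r : ι → ℝ)
    (ha : ∀ i ∈ s, 0 ≤ a i) (hsum : ∑ i ∈ s, a i = 1) (hr : ∀ i ∈ s, 0 ≤ r i)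
    {p : ℝ} (hp : p ∈ Ioo (0:ℝ) 1) :
    ∑ i ∈ s, (r i ^ p) • a i ≤ (∑ i ∈ s, r i • a i) ^ p := by
  have hS : 0 ≤ ∑ i ∈ s, r i • a i :=
    Finset.sum_nonneg fun i hi => smul_nonneg (hr i hi) (ha i hi)
  lift p to NNReal using hp.1.le
  have hp' : p ∈ Ioo (0 : NNReal) 1 := by exact_mod_cast hp
  obtain ⟨μ, hμ⟩ := CFC.exists_measure_nnrpow_eq_integral_cfcₙ_rpowIntegrand₀₁ 𝒜 hp'
  have hm : ∀ i ∈ s, (0 : 𝒜) ≤ algebraMap ℝ 𝒜 (r i) := fun i hi => algebraMap_nonneg _ (hr i hi)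
  have e1 : ∑ i ∈ s, (r i ^ (p : ℝ)) • a i =
      ∫ t in Ioi 0, ∑ i ∈ s, cfcₙ (Real.rpowIntegrand₀₁ p t) (algebraMap ℝ 𝒜 (r i)) * a i ∂μ := by
    rw [integral_finsetSum _ fun i hi => ((hμ _ (hm i hi)).1).mul_const _]
    refine Finset.sum_congr rfl fun i hi => ?_
    have := integral_mul_const_of_integrable (c := a i) (hμ _ (hm i hi)).1
    rw [this, ← (hμ _ (hm i hi)).2, CFC.nnrpow_eq_rpow hp'.1, CFC.rpow_eq_cfc_real (hm i hi),
      cfc_algebraMap, Algebra.smul_def]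
  rw [e1, ← CFC.nnrpow_eq_rpow hp'.1, (hμ _ hS).2]
  refine integral_mono_ae (integrable_finsetSum _ fun i hi => ((hμ _ (hm i hi)).1).mul_const _)
    (hμ _ hS).1 ?_
  filter_upwards [ae_restrict_mem measurableSet_Ioi] with t ht
  exact bellman_integrand_jensen s a r ha hsum hr hp ht

open Polynomial in
lemma bellman_choi (Φ : 𝒜 →ₗ[ℂ] 𝒜) (hΦ1 : Φ 1 = 1) (hΦpos : ∀ a : 𝒜, 0 ≤ a → 0 ≤ Φ a)
    {p : ℝ} (hp : p ∈ Ioo (0:ℝ) 1) (X : 𝒜) (hX0 : 0 ≤ X) (hX1 : X ≤ 1) :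
    Φ (X ^ p) ≤ (Φ X) ^ p := by
  have hsp : ∀ x ∈ spectrum ℝ X, x ∈ Icc (0:ℝ) 1 := fun x hx =>
    ⟨spectrum_nonneg_of_nonneg hX0 hx,
      (le_algebraMap_iff_spectrum_le (r := (1:ℝ)) (a := X)).1 (by simpa using hX1) x hx⟩
  have hmono : ∀ a b : 𝒜, a ≤ b → Φ a ≤ Φ b := fun a b h => by
    have := hΦpos (b - a) (sub_nonneg.2 h)
    rwa [map_sub, sub_nonneg] at this
  let f : C(unitInterval, ℝ) := ⟨fun x => (x : ℝ) ^ p,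
    (Real.continuous_rpow_const hp.1.le).comp continuous_subtype_val⟩
  have key : ∀ ε : ℝ, 0 < ε → Φ (X ^ p) ≤ (Φ X) ^ p + ε • 1 := by
    intro ε hε
    have hB := bernsteinApproximation_uniform f
    obtain ⟨n, hn, hn0⟩ := ((Metric.tendsto_nhds.1 hB ε hε).and
      (Filter.eventually_gt_atTop 0)).exists
    have hn0' : (n : ℝ) ≠ 0 := by exact_mod_cast hn0.ne'
    let b : ℕ → 𝒜 := fun k => aeval X (bernsteinPolynomial ℝ n k)
    have hb0 : ∀ k, 0 ≤ b k := fun k => by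
      change 0 ≤ aeval X (bernsteinPolynomial ℝ n k)
      rw [← cfc_polynomial (R := ℝ) _ X hX0.isSelfAdjoint]
      refine cfc_nonneg fun x hx => ?_
      have h1 := (hsp x hx).1
      have h2 := sub_nonneg.2 (hsp x hx).2
      simp only [bernsteinPolynomial, eval_mul, eval_natCast, eval_pow, eval_X, eval_sub, eval_one]
      positivity
    have hb1 : ∑ k ∈ Finset.range (n + 1), b k = 1 := by
      simpa using congrArg (aeval X) (bernsteinPolynomial.sum ℝ n)
    have hbX : ∑ k ∈ Finset.range (n + 1), ((k : ℝ) / n) • b k = X := by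
      have h := congrArg (aeval X) (bernsteinPolynomial.sum_smul ℝ n)
      simp only [map_sum, map_nsmul, aeval_X] at h
      calc _ = (n : ℝ)⁻¹ • ∑ k ∈ Finset.range (n + 1), k • b k := by
            rw [Finset.smul_sum]
            refine Finset.sum_congr rfl fun k _ => ?_
            rw [← Nat.cast_smul_eq_nsmul ℝ, smul_smul, div_eq_inv_mul]
        _ = X := by
            rw [h, ← Nat.cast_smul_eq_nsmul ℝ, smul_smul, inv_mul_cancel₀ hn0', one_smul]
    have happ : X ^ p ≤ (∑ k ∈ Finset.range (n + 1), (((k : ℝ) / n) ^ p) • b k) + ε • 1 := by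
      let q : ℝ[X] := ∑ k ∈ Finset.range (n + 1), (((k : ℝ) / n) ^ p) • bernsteinPolynomial ℝ n k
        + C ε
      have hq : (∑ k ∈ Finset.range (n + 1), (((k : ℝ) / n) ^ p) • b k) + ε • 1 = aeval X q := by
        simp [q, b, Algebra.algebraMap_eq_smul_one]
      rw [hq, ← cfc_polynomial (R := ℝ) _ X hX0.isSelfAdjoint, CFC.rpow_eq_cfc_real hX0]
      refine cfc_mono (fun x hx => ?_)
        (Real.continuous_rpow_const hp.1.le).continuousOn q.continuous.continuousOn
      have hd := (ContinuousMap.dist_lt_iff hε).1 hn ⟨x, hsp x hx⟩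
      rw [bernsteinApproximation.apply, Real.dist_eq] at hd
      have := (abs_lt.1 hd).1
      have hqe : q.eval x = (∑ k : Fin (n + 1), bernstein n k ⟨x, hsp x hx⟩ •
          f (bernstein.z k)) + ε := by
        simp only [q, eval_add, eval_C, eval_finsetSum, eval_smul, Finset.sum_range]
        congr 1
        refine Finset.sum_congr rfl fun k _ => ?_
        rw [smul_eq_mul, smul_eq_mul, mul_comm]
        rfl
      rw [hqe]
      have hfx : f ⟨x, hsp x hx⟩ = x ^ p := rfl
      rw [hfx] at this
      linarith
    have hj := bellman_jensen (Finset.range (n + 1)) (fun k => Φ (b k)) (fun k => (k : ℝ) / n)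
      (fun k _ => hΦpos _ (hb0 k)) (by rw [← map_sum, hb1, hΦ1]) (fun k _ => by positivity) hp
    have hs : ∀ g : ℕ → ℝ, ∑ k ∈ Finset.range (n + 1), g k • Φ (b k)
        = Φ (∑ k ∈ Finset.range (n + 1), g k • b k) := fun g => by
      simp [map_sum, LinearMap.map_smul_of_tower]
    rw [hs, hs, hbX] at hj
    calc Φ (X ^ p) ≤ Φ ((∑ k ∈ Finset.range (n + 1), (((k : ℝ) / n) ^ p) • b k) + ε • 1) :=
          hmono _ _ happ
      _ = Φ (∑ k ∈ Finset.range (n + 1), (((k : ℝ) / n) ^ p) • b k) + ε • 1 := by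
          rw [map_add, LinearMap.map_smul_of_tower, hΦ1]
      _ ≤ _ := by gcongr
  have hlim : Filter.Tendsto (fun ε : ℝ => (Φ X) ^ p + ε • (1 : 𝒜)) (nhdsWithin 0 (Ioi 0))
      (nhds ((Φ X) ^ p)) := by
    have : Continuous (fun ε : ℝ => (Φ X) ^ p + ε • (1 : 𝒜)) := by fun_prop
    have h := this.tendsto 0
    simp only [zero_smul, add_zero] at h
    exact h.mono_left nhdsWithin_le_nhds
  refine ge_of_tendsto hlim ?_
  filter_upwards [self_mem_nhdsWithin] with ε hε using key ε hε

end Helpers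

/-- The operator Bellman inequality:
`Φ((1-A)^p ∇_λ (1-B)^p) ≤ (Φ(1 - A ∇_λ B))^p` for positive contractions `A, B`,
a unital positive linear map `Φ` and `0 < p < 1`. -/
theorem operator_bellman
    {𝒜 : Type*} [CStarAlgebra 𝒜] [PartialOrder 𝒜] [StarOrderedRing 𝒜]
    (p lam : ℝ) (hp0 : 0 < p) (hp1 : p < 1) (hlam0 : 0 ≤ lam) (hlam1 : lam ≤ 1)
    (A B : 𝒜) (hA0 : 0 ≤ A) (hA1 : A ≤ 1) (hB0 : 0 ≤ B) (hB1 : B ≤ 1)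
    (Φ : 𝒜 →ₗ[ℂ] 𝒜) (hΦ1 : Φ 1 = 1) (hΦpos : ∀ a : 𝒜, 0 ≤ a → 0 ≤ Φ a) :
    Φ ((1 - lam) • cfc (fun t : ℝ => t ^ p) (1 - A) + lam • cfc (fun t : ℝ => t ^ p) (1 - B)) ≤
      cfc (fun t : ℝ => t ^ p) (Φ (1 - ((1 - lam) • A + lam • B))) := by
  have hl : 0 ≤ 1 - lam := sub_nonneg.2 hlam1
  have hX : 1 - ((1 - lam) • A + lam • B) = (1 - lam) • (1 - A) + lam • (1 - B) := by
    module
  have hA' : 0 ≤ 1 - A := sub_nonneg.2 hA1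
  have hB' : 0 ≤ 1 - B := sub_nonneg.2 hB1
  have hX0 : 0 ≤ 1 - ((1 - lam) • A + lam • B) := by
    rw [hX]; exact add_nonneg (smul_nonneg hl hA') (smul_nonneg hlam0 hB')
  have hX1 : 1 - ((1 - lam) • A + lam • B) ≤ 1 :=
    sub_le_self _ (add_nonneg (smul_nonneg hl hA0) (smul_nonneg hlam0 hB0))
  rw [← CFC.rpow_eq_cfc_real hA', ← CFC.rpow_eq_cfc_real hB',
    ← CFC.rpow_eq_cfc_real (hΦpos _ hX0)]
  refine le_trans ?_ (bellman_choi Φ hΦ1 hΦpos ⟨hp0, hp1⟩ _ hX0 hX1)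
  have hc := (CFC.concaveOn_rpow (A := 𝒜) (p := p) ⟨hp0.le, hp1.le⟩).2 (x := 1 - A) (y := 1 - B)
    hA' hB' hl hlam0 (by ring)
  rw [hX]
  have := hΦpos _ (sub_nonneg.2 hc)
  rwa [map_sub, sub_nonneg] at this
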